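/- The extension of the different ideal of B/A to B' is contained in the different ideal of B'/A': 𝔡(B/A)·B' ⊆ 𝔡(B'/A'). Equivalently, as divisors, Diff(E'/F') ≤ Con_{E'/E}(Diff(E/F)), i.e., the different of E'/F' divides the conorm of the different of E/F. -/

import Mathlib

set_option synthInstance.maxHeartbeats 400000
set_option maxHeartbeats 1000000

noncomputable section

open nonZeroDivisors

theorem conorm_aux_orth {F E Ω ι : Type*} [Field F] [Field E] [Field Ω] [Algebra F E] [Algebra F Ω]
    [FiniteDimensional F E] [Algebra.IsSeparable F E] [IsAlgClosed Ω] [Fintype ι]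
    (b c : ι → E) (h : ∀ y : E, ∑ i, Algebra.trace F E (c i * y) • b i = y)
    (σ σ' : E →ₐ[F] Ω) [Decidable (σ' = σ)] :
    ∑ i, σ' (c i) * σ (b i) = if σ' = σ then 1 else 0 := by
  classical
  have hli := linearIndependent_toLinearMap F E Ω
  rw [Fintype.linearIndependent_iff] at hli
  have := hli (fun τ => ∑ i, τ (c i) * σ (b i) - if τ = σ then 1 else 0) (by
    ext y
    have h1 := congrArg σ (h y)
    simp only [map_sum, Algebra.smul_def, map_mul, AlgHom.commutes] at h1
    simp only [trace_eq_sum_embeddings (K := F) (L := E) Ω, map_mul, Finset.sum_mul] at h1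
    simp only [LinearMap.sum_apply, LinearMap.smul_apply, AlgHom.toLinearMap_apply, smul_eq_mul,
      sub_mul, Finset.sum_sub_distrib, ite_mul, one_mul, zero_mul, Finset.sum_ite_eq',
      Finset.mem_univ, if_true, LinearMap.zero_apply, Finset.sum_mul]
    rw [Finset.sum_comm] at h1
    rw [sub_eq_zero, ← h1]
    exact Finset.sum_congr rfl fun _ _ => Finset.sum_congr rfl fun _ _ => by ring) σ'
  rw [sub_eq_zero] at this
  rw [this]
  congr

theorem conorm_aux_expand_of_alg {F E F' E' Ω ι : Type*} [Field F] [Field E] [Field F'] [Field E'] [Field Ω]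
    [Algebra F E] [Algebra F F'] [Algebra F E'] [Algebra E E'] [Algebra F' E']
    [IsScalarTower F E E'] [IsScalarTower F F' E']
    [FiniteDimensional F E] [Algebra.IsSeparable F E]
    [FiniteDimensional F' E'] [Algebra.IsSeparable F' E']
    (hcomp : Algebra.adjoin F
      (Set.range (algebraMap E E') ∪ Set.range (algebraMap F' E')) = ⊤)
    [IsAlgClosed Ω] [Algebra F Ω] [Algebra F' Ω] [IsScalarTower F F' Ω] (τ₀ : E' →ₐ[F'] Ω)
    [Fintype ι]
    (b c : ι → E) (h : ∀ y : E, ∑ i, Algebra.trace F E (c i * y) • b i = y) (x : E') :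
    ∑ i, algebraMap E E' (c i) *
      algebraMap F' E' (Algebra.trace F' E' (algebraMap E E' (b i) * x)) = x := by
  classical
  let r : (E' →ₐ[F'] Ω) → (E →ₐ[F] Ω) := fun τ =>
    (τ.restrictScalars F).comp (IsScalarTower.toAlgHom F E E')
  have hr : ∀ τ, r τ₀ = r τ → τ₀ = τ := by
    intro τ hτ
    have : τ₀.restrictScalars F = τ.restrictScalars F := by
      refine AlgHom.ext_of_adjoin_eq_top hcomp ?_
      rintro _ (⟨e, rfl⟩ | ⟨e, rfl⟩)
      · exact DFunLike.congr_fun hτ e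
      · simp
    exact AlgHom.ext fun y => DFunLike.congr_fun this y
  have hinj : Function.Injective τ₀ := τ₀.toRingHom.injective
  apply hinj
  have htr : ∀ t : E', τ₀ (algebraMap F' E' (Algebra.trace F' E' t)) = ∑ τ : E' →ₐ[F'] Ω, τ t :=
    fun t => (τ₀.commutes _).trans (trace_eq_sum_embeddings (K := F') (L := E') Ω)
  rw [map_sum]
  simp only [map_mul τ₀, htr, map_mul, Finset.mul_sum]
  rw [Finset.sum_comm]
  have key : ∀ τ : E' →ₐ[F'] Ω, ∑ i, τ₀ (algebraMap E E' (c i)) *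
      (τ (algebraMap E E' (b i)) * τ x) = if τ₀ = τ then τ x else 0 := by
    intro τ
    have := conorm_aux_orth (Ω := Ω) b c h (r τ) (r τ₀)
    simp only [← mul_assoc, ← Finset.sum_mul]
    have h2 : ∑ i, τ₀ (algebraMap E E' (c i)) * τ (algebraMap E E' (b i)) =
      if r τ₀ = r τ then 1 else 0 := this
    rw [h2]
    by_cases h3 : τ₀ = τ
    · simp [h3]
    · rw [if_neg h3, if_neg (fun h4 => h3 (hr _ h4)), zero_mul]
  rw [Finset.sum_congr rfl fun τ _ => key τ]
  simp

theorem conorm_aux_expand {F E F' E' ι : Type*} [Field F] [Field E] [Field F'] [Field E']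
    [Algebra F E] [Algebra F F'] [Algebra F E'] [Algebra E E'] [Algebra F' E']
    [IsScalarTower F E E'] [IsScalarTower F F' E']
    [FiniteDimensional F E] [Algebra.IsSeparable F E]
    [FiniteDimensional F' E'] [Algebra.IsSeparable F' E']
    (hcomp : Algebra.adjoin F
      (Set.range (algebraMap E E') ∪ Set.range (algebraMap F' E')) = ⊤)
    [Fintype ι]
    (b c : ι → E) (h : ∀ y : E, ∑ i, Algebra.trace F E (c i * y) • b i = y) (x : E') :
    ∑ i, algebraMap E E' (c i) *
      algebraMap F' E' (Algebra.trace F' E' (algebraMap E E' (b i) * x)) = x := by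
  exact conorm_aux_expand_of_alg (Ω := AlgebraicClosure E') hcomp
    (IsScalarTower.toAlgHom F' E' (AlgebraicClosure E')) b c h x

theorem conorm_aux_dual (A F E B : Type*)
    [CommRing A] [IsDedekindDomain A] [Field F] [Field E] [Algebra A F] [IsFractionRing A F]
    [Algebra F E] [FiniteDimensional F E] [Algebra.IsSeparable F E]
    [Algebra A E] [IsScalarTower A F E]
    [CommRing B] [IsDedekindDomain B] [Algebra A B] [Algebra B E] [IsScalarTower A B E]
    [IsIntegralClosure B A E] [Module.IsTorsionFree A B] :
    ∃ (n : ℕ) (b : Fin n → B) (c : Fin n → E),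
      (∀ i, c i ∈ Submodule.traceDual A F (1 : Submodule B E)) ∧
      ∀ y : E, ∑ i, Algebra.trace F E (c i * y) • algebraMap B E (b i) = y := by
  have : Module.Finite A B := IsIntegralClosure.finite A F E B
  have : Module.FinitePresentation A B := Module.finitePresentation_of_finite A B
  have : Module.Projective A B := Module.Flat.projective_of_finitePresentation
  obtain ⟨n, f, g, -, -, hfg⟩ := Module.Finite.exists_comp_eq_id_of_projective A B
  have := IsIntegralClosure.isLocalization A F E B
  have hloc : IsLocalizedModule A⁰ (IsScalarTower.toAlgHom A B E).toLinearMap := inferInstance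
  let φ : Fin n → (E →ₗ[F] F) := fun i =>
    IsLocalizedModule.mapExtendScalars A⁰ (IsScalarTower.toAlgHom A B E).toLinearMap
      (Algebra.linearMap A F) F ((LinearMap.proj i).comp g)
  have hφ : ∀ i x, φ i (algebraMap B E x) = algebraMap A F (g x i) := fun i x =>
    IsLocalizedModule.map_apply A⁰ (IsScalarTower.toAlgHom A B E).toLinearMap
      (Algebra.linearMap A F) ((LinearMap.proj i).comp g) x
  let c : Fin n → E := fun i => (Algebra.traceForm F E).toDual (traceForm_nondegenerate F E) |>.symm (φ i)
  have hc : ∀ i y, Algebra.trace F E (c i * y) = φ i y := fun i y => by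
    have := LinearMap.BilinForm.apply_toDual_symm_apply (hB := traceForm_nondegenerate F E) (f := φ i) (v := y)
    exact this
  refine ⟨n, fun i => f (Pi.single i 1), c, ?_, ?_⟩
  · intro i
    rw [Submodule.mem_traceDual]
    intro a ha
    obtain ⟨a, rfl⟩ := Submodule.mem_one.mp ha
    rw [Algebra.traceForm_apply, hc, hφ]
    exact ⟨_, rfl⟩
  · intro y
    simp only [hc]
    have hB : ∀ x : B, ∑ i, φ i (algebraMap B E x) • algebraMap B E (f (Pi.single i 1)) =
        algebraMap B E x := by
      intro x
      conv_rhs => rw [← LinearMap.id_apply (R := A) x, ← hfg, LinearMap.comp_apply,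
        LinearMap.pi_apply_eq_sum_univ f, map_sum]
      refine Finset.sum_congr rfl fun i _ => ?_
      rw [hφ, algebraMap_smul, Algebra.smul_def, Algebra.smul_def, map_mul,
        ← IsScalarTower.algebraMap_apply]
      congr! 3
      ext j
      simp [Pi.single_apply, eq_comm]
    obtain ⟨⟨x, s⟩, hs⟩ := IsLocalizedModule.surj A⁰ (IsScalarTower.toAlgHom A B E).toLinearMap y
    have hs' : algebraMap A F (s : A) • y = algebraMap B E x := by
      rw [algebraMap_smul]; exact hs
    have hs0 : algebraMap A F (s : A) ≠ 0 := IsFractionRing.to_map_ne_zero_of_mem_nonZeroDivisors s.2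
    have h3 := hB x
    rw [← hs'] at h3
    simp only [map_smul, smul_assoc, ← Finset.smul_sum] at h3
    exact smul_right_injective E hs0 h3

theorem conorm_different_le_different_of_compositum
    (A F E F' E' B A' B' : Type*)
    [CommRing A] [IsDedekindDomain A]
    [Field F] [Field E] [Field F'] [Field E']
    [Algebra A F] [IsFractionRing A F]
    [Algebra F E] [Algebra F F'] [Algebra F E'] [Algebra E E'] [Algebra F' E']
    [IsScalarTower F E E'] [IsScalarTower F F' E']
    [FiniteDimensional F E] [Algebra.IsSeparable F E]
    [FiniteDimensional F F'] [Algebra.IsSeparable F F']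
    [FiniteDimensional F E'] [Algebra.IsSeparable F E']
    [Algebra A E] [IsScalarTower A F E] [Algebra A F'] [IsScalarTower A F F']
    [Algebra A E'] [IsScalarTower A F E']
    (hres : ∀ P : Ideal A, P.IsMaximal → Finite (A ⧸ P))
    -- `E'` is the compositum of `E` and `F'`
    (hcomp : Algebra.adjoin F
      (Set.range (algebraMap E E') ∪ Set.range (algebraMap F' E')) = ⊤)
    -- `B`, `A'`, `B'` are the integral closures of `A` in `E`, `F'`, `E'`
    [CommRing B] [IsDedekindDomain B] [Algebra A B] [Algebra B E] [IsScalarTower A B E]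
    [IsIntegralClosure B A E] [NoZeroSMulDivisors A B]
    [CommRing A'] [IsDedekindDomain A'] [Algebra A A'] [Algebra A' F'] [IsScalarTower A A' F']
    [IsIntegralClosure A' A F'] [NoZeroSMulDivisors A A']
    [CommRing B'] [IsDedekindDomain B'] [Algebra A B'] [Algebra B' E'] [IsScalarTower A B' E']
    [IsIntegralClosure B' A E'] [NoZeroSMulDivisors A B']
    [Algebra A' E'] [IsScalarTower A' F' E'] [Algebra B E'] [IsScalarTower B E E']
    [Algebra A' B'] [IsScalarTower A A' B'] [IsScalarTower A' B' E'] [NoZeroSMulDivisors A' B']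
    [Algebra B B'] [IsScalarTower A B B'] [IsScalarTower B B' E']
    :
    Ideal.map (algebraMap B B') (differentIdeal A B) ≤ differentIdeal A' B' := by
  have : FiniteDimensional F' E' := FiniteDimensional.right F F' E'
  have : Algebra.IsSeparable F' E' := Algebra.isSeparable_tower_top_of_isSeparable F F' E'
  have := IsIntegralClosure.isFractionRing_of_finite_extension A F E B
  have := IsIntegralClosure.isFractionRing_of_finite_extension A F F' A'
  have := IsIntegralClosure.isFractionRing_of_finite_extension A F E' B'
  have : IsScalarTower A A' E' := IsScalarTower.of_algebraMap_eq fun x => by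
    rw [IsScalarTower.algebraMap_apply A B' E', IsScalarTower.algebraMap_apply A A' B',
      ← IsScalarTower.algebraMap_apply A' B' E']
  have : Algebra.IsIntegral A A' := IsIntegralClosure.isIntegral_algebra A F'
  have : Algebra.IsIntegral A B' := IsIntegralClosure.isIntegral_algebra A E'
  have : Algebra.IsIntegral A' B' := Algebra.IsIntegral.tower_top A
  have : IsIntegralClosure B' A' E' := IsIntegralClosure.tower_top (R := A)
  have : Module.IsTorsionFree A B := inferInstance
  have : Module.IsTorsionFree A' B' := inferInstance
  obtain ⟨n, b, c, hc, hbc⟩ := conorm_aux_dual A F E B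
  rw [Ideal.map_le_iff_le_comap]
  intro d hd
  rw [Ideal.mem_comap]
  have h1 : algebraMap B E d ∈ IsLocalization.coeSubmodule E (differentIdeal A B) :=
    ⟨d, hd, rfl⟩
  rw [coeSubmodule_differentIdeal A F, Submodule.mem_div_iff_forall_mul_mem] at h1
  suffices h2 : algebraMap B' E' (algebraMap B B' d) ∈
      IsLocalization.coeSubmodule E' (differentIdeal A' B') by
    obtain ⟨d', hd', h3⟩ := h2
    rwa [← IsFractionRing.injective B' E' h3]
  rw [coeSubmodule_differentIdeal A' F', Submodule.mem_div_iff_forall_mul_mem]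
  intro x hx
  rw [Submodule.mem_traceDual] at hx
  rw [← conorm_aux_expand (F := F) (F' := F') hcomp (fun i => algebraMap B E (b i)) c hbc x, Finset.mul_sum]
  refine Submodule.sum_mem _ fun i _ => ?_
  obtain ⟨u, hu⟩ := Submodule.mem_one.mp (h1 (c i) (hc i))
  obtain ⟨v, hv⟩ := hx (algebraMap B' E' (algebraMap B B' (b i))) (Submodule.mem_one.mpr ⟨_, rfl⟩)
  rw [Algebra.traceForm_apply, mul_comm, ← IsScalarTower.algebraMap_apply B B' E',
    IsScalarTower.algebraMap_apply B E E'] at hv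
  rw [← hv, ← mul_assoc, ← IsScalarTower.algebraMap_apply B B' E',
    IsScalarTower.algebraMap_apply B E E', ← map_mul, ← hu, ← IsScalarTower.algebraMap_apply,
    ← IsScalarTower.algebraMap_apply, IsScalarTower.algebraMap_apply B B' E',
    IsScalarTower.algebraMap_apply A' B' E', ← map_mul]
  exact Submodule.mem_one.mpr ⟨_, rfl⟩
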